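/- Every concise rank-3 tensor T ∈ ℂ²⊗ℂ²⊗ℂ²⊗ℂ² is not identifiable; in fact T admits infinitely many pairwise inequivalent decompositions as a sum of 3 elementary tensors. -/

import Mathlib

open scoped BigOperators

/-- A tensor `T ∈ ℂ^a ⊗ ℂ^b ⊗ ℂ^c ⊗ ℂ^d` (in coordinates) is elementary if it is
`u ⊗ v ⊗ w ⊗ x` for some vectors `u, v, w, x`. -/
def Elementary4 {a b c d : ℕ} (T : Fin a → Fin b → Fin c → Fin d → ℂ) : Prop :=
  ∃ (u : Fin a → ℂ) (v : Fin b → ℂ) (w : Fin c → ℂ) (x : Fin d → ℂ),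
    T = fun i j k l => u i * v j * w k * x l

/-- The rank of a tensor: the minimal number of elementary tensors summing to it. -/
noncomputable def rank4 {a b c d : ℕ} (T : Fin a → Fin b → Fin c → Fin d → ℂ) : ℕ :=
  sInf {r | ∃ t : Fin r → (Fin a → Fin b → Fin c → Fin d → ℂ),
    (∀ s, Elementary4 (t s)) ∧ T = ∑ s, t s}

/-- A tensor is concise if each of its flattenings has maximal rank. -/
def Concise4 {a b c d : ℕ} (T : Fin a → Fin b → Fin c → Fin d → ℂ) : Prop :=
  Submodule.span ℂ {x : Fin a → ℂ | ∃ j k l, x = fun i => T i j k l} = ⊤ ∧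
  Submodule.span ℂ {x : Fin b → ℂ | ∃ i k l, x = fun j => T i j k l} = ⊤ ∧
  Submodule.span ℂ {x : Fin c → ℂ | ∃ i j l, x = fun k => T i j k l} = ⊤ ∧
  Submodule.span ℂ {x : Fin d → ℂ | ∃ i j k, x = fun l => T i j k l} = ⊤

/-- `T` is identifiable with respect to decompositions of length `r`. -/
def IdentifiableWith4 {a b c d : ℕ} (T : Fin a → Fin b → Fin c → Fin d → ℂ)
    (r : ℕ) : Prop :=
  ∀ t t' : Fin r → (Fin a → Fin b → Fin c → Fin d → ℂ),
    (∀ s, Elementary4 (t s)) → (∀ s, Elementary4 (t' s)) →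
    T = ∑ s, t s → T = ∑ s, t' s →
    ∃ σ : Equiv.Perm (Fin r), ∀ s, t' s = t (σ s)

/-- The elementary tensor `u ⊗ v ⊗ w ⊗ x`. -/
def elem4 (u v w x : Fin 2 → ℂ) : Fin 2 → Fin 2 → Fin 2 → Fin 2 → ℂ :=
  fun i j k l => u i * v j * w k * x l

lemma elementary4_elem4 (u v w x : Fin 2 → ℂ) : Elementary4 (elem4 u v w x) :=
  ⟨u, v, w, x, rfl⟩

/-- The elementary tensors occurring in some length-3 decomposition of `T`. -/
def summands (T : Fin 2 → Fin 2 → Fin 2 → Fin 2 → ℂ) :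
    Set (Fin 2 → Fin 2 → Fin 2 → Fin 2 → ℂ) :=
  {X | Elementary4 X ∧ ∃ Y Z, Elementary4 Y ∧ Elementary4 Z ∧ T = X + Y + Z}

/-- If infinitely many elementary tensors occur in length-3 decompositions of `T`, then there are
infinitely many inequivalent decompositions. -/
lemma exists_inequivalent_of_infinite_summands {T : Fin 2 → Fin 2 → Fin 2 → Fin 2 → ℂ}
    (h : (summands T).Infinite) :
    ∃ D : ℕ → (Fin 3 → (Fin 2 → Fin 2 → Fin 2 → Fin 2 → ℂ)),
      (∀ m, (∀ s, Elementary4 (D m s)) ∧ T = ∑ s, D m s) ∧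
      ∀ m m', m ≠ m' →
        ¬ ∃ σ : Equiv.Perm (Fin 3), ∀ s, D m' s = D m (σ s) := by
  set R : Set (Set (Fin 2 → Fin 2 → Fin 2 → Fin 2 → ℂ)) :=
    {A | ∃ t : Fin 3 → (Fin 2 → Fin 2 → Fin 2 → Fin 2 → ℂ),
      ((∀ s, Elementary4 (t s)) ∧ T = ∑ s, t s) ∧ A = Set.range t} with hR
  have hinf : R.Infinite := by
    intro hfin
    refine h ((hfin.sUnion ?_).subset ?_)
    · rintro A ⟨t, -, rfl⟩
      exact Set.finite_range t
    · rintro X ⟨hX, Y, Z, hY, hZ, hT⟩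
      refine ⟨Set.range ![X, Y, Z], ⟨![X, Y, Z], ⟨?_, ?_⟩, rfl⟩, ⟨0, rfl⟩⟩
      · intro s
        fin_cases s <;> assumption
      · rw [Fin.sum_univ_three]
        exact hT
  have hmem : ∀ m, ((hinf.natEmbedding R m : R) : Set _) ∈ R := fun m => Subtype.property _
  choose D hD hrange using hmem
  refine ⟨D, hD, ?_⟩
  rintro m m' hne ⟨σ, hσ⟩
  apply hne
  apply (hinf.natEmbedding R).injective
  apply Subtype.ext
  rw [hrange m, hrange m']
  have : D m' = D m ∘ σ := funext hσ
  rw [this, σ.surjective.range_comp]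

lemma infinite_of_injOn {α : Type*} {S : Set α} {A : Set ℂ} (hA : A.Infinite) (f : ℂ → α)
    (hf : Set.InjOn f A) (hm : Set.MapsTo f A S) : S.Infinite :=
  Set.infinite_of_injOn_mapsTo hf hm hA

lemma infinite_eval_ne_zero {Q : Polynomial ℂ} (h : Q.eval 0 ≠ 0) :
    {z : ℂ | Q.eval z ≠ 0}.Infinite := by
  have hQ : Q ≠ 0 := by
    rintro rfl
    simp at h
  have hfin : {z : ℂ | Q.eval z = 0}.Finite := Polynomial.finite_setOfPred_isRoot hQ
  exact hfin.infinite_compl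

/-- A `2 × 2` matrix with vanishing determinant is an outer product. -/
lemma exists_outer_of_det_eq_zero (N : Fin 2 → Fin 2 → ℂ)
    (h : N 0 0 * N 1 1 - N 0 1 * N 1 0 = 0) :
    ∃ y z : Fin 2 → ℂ, ∀ j k, N j k = y j * z k := by
  by_cases h0 : N 0 0 = 0
  · have h1 : N 0 1 * N 1 0 = 0 := by
      rw [h0] at h
      linear_combination -h
    rcases mul_eq_zero.mp h1 with h1 | h1
    · refine ⟨![0, 1], N 1, ?_⟩
      intro j k
      fin_cases j <;> fin_cases k <;> simp [h0, h1]
    · refine ⟨![N 0 1, N 1 1], ![0, 1], ?_⟩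
      intro j k
      fin_cases j <;> fin_cases k <;> simp [h0, h1]
  · refine ⟨![1, N 1 0 / N 0 0], N 0, ?_⟩
    intro j k
    fin_cases j <;> fin_cases k <;> simp
    · field_simp
    · field_simp
      linear_combination h

/-- Cayley's hyperdeterminant of a `2 × 2 × 2` array. -/
def hyperdet {R : Type*} [CommRing R] (P : Fin 2 → Fin 2 → Fin 2 → R) : R :=
  (P 0 0 0 * P 1 1 1 + P 0 1 1 * P 1 0 0 - P 0 0 1 * P 1 1 0 - P 0 1 0 * P 1 0 1) ^ 2
    - 4 * (P 0 0 0 * P 0 1 1 - P 0 0 1 * P 0 1 0) * (P 1 0 0 * P 1 1 1 - P 1 0 1 * P 1 1 0)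

/-- A binary quadratic form with nonzero discriminant has two distinct projective zeros. -/
lemma exists_two_zeros (A B C : ℂ) (h : B ^ 2 - 4 * A * C ≠ 0) :
    ∃ s t s' t' : ℂ, s * t' - s' * t ≠ 0 ∧ A * s ^ 2 + B * s * t + C * t ^ 2 = 0 ∧
      A * s' ^ 2 + B * s' * t' + C * t' ^ 2 = 0 := by
  by_cases hA : A = 0
  · subst hA
    refine ⟨1, 0, -C, B, ?_, by ring, by ring⟩
    intro hB
    apply h
    linear_combination B * hB
  · obtain ⟨δ, hδ⟩ := IsAlgClosed.exists_pow_nat_eq (B ^ 2 - 4 * A * C) (n := 2) (by norm_num)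
    have hδ0 : δ ≠ 0 := by
      rintro rfl
      apply h
      rw [← hδ]
      ring
    refine ⟨-B + δ, 2 * A, -B - δ, 2 * A, ?_, ?_, ?_⟩
    · have : (-B + δ) * (2 * A) - (-B - δ) * (2 * A) = 4 * A * δ := by ring
      rw [this]
      simp [hA, hδ0]
    · linear_combination A * hδ
    · linear_combination A * hδ

/-- A `2 × 2 × 2` array with nonzero hyperdeterminant is a sum of two elementary ones. -/
lemma exists_two_of_hyperdet_ne_zero (P : Fin 2 → Fin 2 → Fin 2 → ℂ) (h : hyperdet P ≠ 0) :
    ∃ u v w u' v' w' : Fin 2 → ℂ,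
      ∀ i j k, P i j k = u i * v j * w k + u' i * v' j * w' k := by
  obtain ⟨s, t, s', t', hD, h1, h2⟩ := exists_two_zeros _ _ _ h
  obtain ⟨y, z, hN⟩ := exists_outer_of_det_eq_zero (fun j k => s * P 0 j k + t * P 1 j k)
    (by linear_combination h1)
  obtain ⟨y', z', hN'⟩ := exists_outer_of_det_eq_zero (fun j k => s' * P 0 j k + t' * P 1 j k)
    (by linear_combination h2)
  obtain ⟨E, hE⟩ : ∃ E, E = s * t' - s' * t := ⟨_, rfl⟩
  rw [← hE] at hD
  refine ⟨![t' / E, -s' / E], y, z,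
    ![-t / E, s / E], y', z', ?_⟩
  intro i j k
  have e := hN j k
  have e' := hN' j k
  fin_cases i
  · simp
    field_simp
    linear_combination t' * e - t * e' + P 0 j k * hE
  · simp
    field_simp
    linear_combination s * e' - s' * e + P 1 j k * hE

lemma exists_eq_smul_of_mul_eq_mul {a a' : Fin 2 → ℂ} (ha : a ≠ 0) (ha' : a' ≠ 0)
    (h : a 0 * a' 1 = a 1 * a' 0) : ∃ κ : ℂ, κ ≠ 0 ∧ a' = κ • a := by
  have key : ∃ κ : ℂ, a' = κ • a := by
    by_cases h0 : a 0 = 0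
    · have h1 : a 1 ≠ 0 := by
        intro h1
        apply ha
        ext i
        fin_cases i <;> simp [h0, h1]
      refine ⟨a' 1 / a 1, ?_⟩
      ext i
      fin_cases i
      · have : a 1 * a' 0 = 0 := by rw [← h, h0, zero_mul]
        simpa [h0, h1] using this
      · simp [h1]
    · refine ⟨a' 0 / a 0, ?_⟩
      ext i
      fin_cases i
      · simp [h0]
      · simp
        field_simp
        linear_combination h
  obtain ⟨κ, hκ⟩ := key
  refine ⟨κ, ?_, hκ⟩
  rintro rfl
  exact ha' (by simpa using hκ)

lemma exists_apply_ne_zero {a : Fin 2 → ℂ} (ha : a ≠ 0) : ∃ i, a i ≠ 0 :=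
  Function.ne_iff.mp ha

/-- Two parallel first factors and two parallel second factors. -/
lemma infinite_summands_of_two_parallel {a b c d c' d' u v w x : Fin 2 → ℂ} (κ μ : ℂ)
    (ha : a ≠ 0) (hb : b ≠ 0) (hc : c ≠ 0) (hd' : d' ≠ 0) :
    (summands (elem4 a b c d + elem4 (κ • a) (μ • b) c' d' + elem4 u v w x)).Infinite := by
  refine infinite_of_injOn Set.infinite_univ (fun z => elem4 a b c (d + z • d')) ?_ ?_
  · intro z _ z' _ h
    obtain ⟨i, hi⟩ := exists_apply_ne_zero ha
    obtain ⟨j, hj⟩ := exists_apply_ne_zero hb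
    obtain ⟨k, hk⟩ := exists_apply_ne_zero hc
    obtain ⟨l, hl⟩ := exists_apply_ne_zero hd'
    have e := congrFun (congrFun (congrFun (congrFun h i) j) k) l
    simpa [elem4, hi, hj, hk, hl] using e
  · intro z _
    refine ⟨elementary4_elem4 _ _ _ _, elem4 a b ((κ * μ) • c' - z • c) d', elem4 u v w x,
      elementary4_elem4 _ _ _ _, elementary4_elem4 _ _ _ _, ?_⟩
    ext i j k l
    simp [elem4]
    ring

/-- Two parallel first factors, all other factors of these two summands being independent. -/
lemma infinite_summands_of_parallel_of_det_ne_zero {a b c d b' c' d' u v w x : Fin 2 → ℂ} {κ : ℂ}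
    (hκ : κ ≠ 0) (ha : a ≠ 0) (hv : v ≠ 0) (hw : w ≠ 0) (hx : x ≠ 0)
    (hb : b 0 * b' 1 - b 1 * b' 0 ≠ 0) (hc : c 0 * c' 1 - c 1 * c' 0 ≠ 0)
    (hd : d 0 * d' 1 - d 1 * d' 0 ≠ 0) :
    (summands (elem4 a b c d + elem4 (κ • a) b' c' d' + elem4 u v w x)).Infinite := by
  set Q : Polynomial ℂ := hyperdet (fun i j k =>
    Polynomial.C (b i * c j * d k + κ * (b' i * c' j * d' k))
      - Polynomial.X * Polynomial.C (v i * w j * x k)) with hQ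
  have hev : ∀ z, Q.eval z = hyperdet (fun i j k =>
      b i * c j * d k + κ * (b' i * c' j * d' k) - z * (v i * w j * x k)) := by
    intro z
    simp [hQ, hyperdet]
  have h0 : Q.eval 0 ≠ 0 := by
    have : Q.eval 0 = (κ * (b 0 * b' 1 - b 1 * b' 0) * (c 0 * c' 1 - c 1 * c' 0)
        * (d 0 * d' 1 - d 1 * d' 0)) ^ 2 := by
      rw [hev, hyperdet]
      ring
    rw [this]
    exact pow_ne_zero _ (mul_ne_zero (mul_ne_zero (mul_ne_zero hκ hb) hc) hd)
  refine infinite_of_injOn (infinite_eval_ne_zero h0) (fun z => elem4 (u + z • a) v w x) ?_ ?_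
  · intro z _ z' _ h
    obtain ⟨i, hi⟩ := exists_apply_ne_zero ha
    obtain ⟨j, hj⟩ := exists_apply_ne_zero hv
    obtain ⟨k, hk⟩ := exists_apply_ne_zero hw
    obtain ⟨l, hl⟩ := exists_apply_ne_zero hx
    have e := congrFun (congrFun (congrFun (congrFun h i) j) k) l
    simpa [elem4, hi, hj, hk, hl] using e
  · intro z hz
    rw [Set.mem_ofPred_eq, hev] at hz
    obtain ⟨p, q, r, p', q', r', hP⟩ := exists_two_of_hyperdet_ne_zero _ hz
    refine ⟨elementary4_elem4 _ _ _ _, elem4 a p q r, elem4 a p' q' r',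
      elementary4_elem4 _ _ _ _, elementary4_elem4 _ _ _ _, ?_⟩
    ext i j k l
    have e := hP j k l
    simp [elem4]
    linear_combination a i * e

lemma infinite_summands_of_map {T : Fin 2 → Fin 2 → Fin 2 → Fin 2 → ℂ}
    (e : (Fin 2 → Fin 2 → Fin 2 → Fin 2 → ℂ) → (Fin 2 → Fin 2 → Fin 2 → Fin 2 → ℂ))
    (hadd : ∀ X Y, e (X + Y) = e X + e Y) (hinv : Function.Involutive e)
    (hel : ∀ X, Elementary4 X → Elementary4 (e X)) (h : (summands (e T)).Infinite) :
    (summands T).Infinite := by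
  refine Set.infinite_of_injOn_mapsTo (f := e) hinv.injective.injOn ?_ h
  rintro X ⟨hX, Y, Z, hY, hZ, hT⟩
  refine ⟨hel _ hX, e Y, e Z, hel _ hY, hel _ hZ, ?_⟩
  rw [← hadd, ← hadd, ← hT, hinv]

lemma infinite_summands_swap01 {T : Fin 2 → Fin 2 → Fin 2 → Fin 2 → ℂ}
    (h : (summands (fun i j k l => T j i k l)).Infinite) : (summands T).Infinite := by
  refine infinite_summands_of_map (fun T i j k l => T j i k l) (fun _ _ => rfl) (fun _ => rfl) ?_ h
  rintro X ⟨u, v, w, x, rfl⟩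
  refine ⟨v, u, w, x, ?_⟩
  ext i j k l
  ring

lemma infinite_summands_swap02 {T : Fin 2 → Fin 2 → Fin 2 → Fin 2 → ℂ}
    (h : (summands (fun i j k l => T k j i l)).Infinite) : (summands T).Infinite := by
  refine infinite_summands_of_map (fun T i j k l => T k j i l) (fun _ _ => rfl) (fun _ => rfl) ?_ h
  rintro X ⟨u, v, w, x, rfl⟩
  refine ⟨w, v, u, x, ?_⟩
  ext i j k l
  ring

lemma infinite_summands_swap03 {T : Fin 2 → Fin 2 → Fin 2 → Fin 2 → ℂ}
    (h : (summands (fun i j k l => T l j k i)).Infinite) : (summands T).Infinite := by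
  refine infinite_summands_of_map (fun T i j k l => T l j k i) (fun _ _ => rfl) (fun _ => rfl) ?_ h
  rintro X ⟨u, v, w, x, rfl⟩
  refine ⟨x, v, w, u, ?_⟩
  ext i j k l
  ring

lemma infinite_summands_swap12 {T : Fin 2 → Fin 2 → Fin 2 → Fin 2 → ℂ}
    (h : (summands (fun i j k l => T i k j l)).Infinite) : (summands T).Infinite := by
  refine infinite_summands_of_map (fun T i j k l => T i k j l) (fun _ _ => rfl) (fun _ => rfl) ?_ h
  rintro X ⟨u, v, w, x, rfl⟩
  refine ⟨u, w, v, x, ?_⟩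
  ext i j k l
  ring

lemma infinite_summands_swap13 {T : Fin 2 → Fin 2 → Fin 2 → Fin 2 → ℂ}
    (h : (summands (fun i j k l => T i l k j)).Infinite) : (summands T).Infinite := by
  refine infinite_summands_of_map (fun T i j k l => T i l k j) (fun _ _ => rfl) (fun _ => rfl) ?_ h
  rintro X ⟨u, v, w, x, rfl⟩
  refine ⟨u, x, w, v, ?_⟩
  ext i j k l
  ring

lemma infinite_summands_of_parallel_pair {a b c d a' b' c' d' u v w x : Fin 2 → ℂ}
    (ha : a ≠ 0) (hb : b ≠ 0) (hc : c ≠ 0) (hd : d ≠ 0) (ha' : a' ≠ 0) (hb' : b' ≠ 0)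
    (hc' : c' ≠ 0) (hd' : d' ≠ 0) (hv : v ≠ 0) (hw : w ≠ 0) (hx : x ≠ 0)
    (h : a 0 * a' 1 = a 1 * a' 0) :
    (summands (elem4 a b c d + elem4 a' b' c' d' + elem4 u v w x)).Infinite := by
  obtain ⟨κ, hκ, rfl⟩ := exists_eq_smul_of_mul_eq_mul ha ha' h
  by_cases h1 : b 0 * b' 1 = b 1 * b' 0
  · obtain ⟨μ, -, rfl⟩ := exists_eq_smul_of_mul_eq_mul hb hb' h1
    exact infinite_summands_of_two_parallel κ μ ha hb hc hd'
  by_cases h2 : c 0 * c' 1 = c 1 * c' 0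
  · obtain ⟨μ, -, rfl⟩ := exists_eq_smul_of_mul_eq_mul hc hc' h2
    apply infinite_summands_swap12
    convert infinite_summands_of_two_parallel (d := d) (c' := b') (u := u) (v := w) (w := v)
      (x := x) κ μ ha hc hb hd' using 2
    ext i j k l
    simp [elem4]
    ring
  by_cases h3 : d 0 * d' 1 = d 1 * d' 0
  · obtain ⟨μ, -, rfl⟩ := exists_eq_smul_of_mul_eq_mul hd hd' h3
    apply infinite_summands_swap13
    convert infinite_summands_of_two_parallel (d := b) (c' := c') (u := u) (v := x) (w := w)
      (x := v) κ μ ha hd hc hb' using 2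
    ext i j k l
    simp [elem4]
    ring
  exact infinite_summands_of_parallel_of_det_ne_zero hκ ha hv hw hx (sub_ne_zero.mpr h1)
    (sub_ne_zero.mpr h2) (sub_ne_zero.mpr h3)

lemma infinite_summands_of_parallel {a b c d : Fin 3 → Fin 2 → ℂ} (ha : ∀ s, a s ≠ 0)
    (hb : ∀ s, b s ≠ 0) (hc : ∀ s, c s ≠ 0) (hd : ∀ s, d s ≠ 0) {i j : Fin 3} (hij : i ≠ j)
    (h : a i 0 * a j 1 = a i 1 * a j 0) :
    (summands (∑ s, elem4 (a s) (b s) (c s) (d s))).Infinite := by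
  obtain ⟨k, hk⟩ : ∃ k, ∑ s, elem4 (a s) (b s) (c s) (d s) = elem4 (a i) (b i) (c i) (d i)
      + elem4 (a j) (b j) (c j) (d j) + elem4 (a k) (b k) (c k) (d k) := by
    have hk : ∃ k, k ≠ i ∧ k ≠ j := by
      clear h
      revert i j
      decide
    obtain ⟨k, hki, hkj⟩ := hk
    refine ⟨k, ?_⟩
    have huniv : (Finset.univ : Finset (Fin 3)) = {i, j, k} := by
      clear h
      revert i j k
      decide
    rw [huniv, Finset.sum_insert (by simp [hij, hki.symm]), Finset.sum_insert (by simp [hkj.symm]),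
      Finset.sum_singleton, add_assoc]
  rw [hk]
  exact infinite_summands_of_parallel_pair (ha i) (hb i) (hc i) (hd i) (ha j) (hb j) (hc j) (hd j)
    (hb k) (hc k) (hd k) h

/-- Three pairwise independent vectors of the plane, written with nodes `0, 1, -1`. -/
lemma exists_nodes {a : Fin 3 → Fin 2 → ℂ}
    (h : ∀ i j, i ≠ j → a i 0 * a j 1 ≠ a i 1 * a j 0) :
    ∃ (f g : Fin 2 → ℂ) (q r : ℂ), f 0 * g 1 - f 1 * g 0 ≠ 0 ∧ q ≠ 0 ∧ r ≠ 0 ∧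
      a 0 = f ∧ a 1 = q • (f + g) ∧ a 2 = r • (f - g) := by
  have h01 := sub_ne_zero.mpr (h 0 1 (by decide))
  have h02 := sub_ne_zero.mpr (h 0 2 (by decide))
  have h12 := sub_ne_zero.mpr (h 1 2 (by decide))
  set A := a 0 0 * a 1 1 - a 0 1 * a 1 0 with hA
  set B := a 0 0 * a 2 1 - a 0 1 * a 2 0 with hB
  set C := a 1 0 * a 2 1 - a 1 1 * a 2 0 with hC
  have hdep : ∀ i, C * a 0 i = B * a 1 i - A * a 2 i := by
    intro i
    fin_cases i <;> simp [hA, hB, hC] <;> ring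
  have hg : ∀ i, C * ((B / C) * a 1 i + (A / C) * a 2 i) = B * a 1 i + A * a 2 i := by
    intro i
    field_simp
  refine ⟨a 0, fun i => (B / C) * a 1 i + (A / C) * a 2 i, C / (2 * B), -C / (2 * A), ?_, ?_, ?_,
    rfl, ?_, ?_⟩
  · intro h0
    have : 2 * A * B = 0 := by
      linear_combination C * h0 - a 0 0 * hg 1 + a 0 1 * hg 0 - B * hA - A * hB
    simp [h01, h02] at this
  · exact div_ne_zero h12 (mul_ne_zero two_ne_zero h02)
  · exact div_ne_zero (neg_ne_zero.mpr h12) (mul_ne_zero two_ne_zero h01)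
  · ext i
    simp
    field_simp
    linear_combination -(hdep i)
  · ext i
    simp
    field_simp
    linear_combination hdep i

/-- A moment sequence `m₀, …, m₄` annihilated by a cubic with three distinct roots is represented by
weights at these roots. -/
lemma exists_weights {x y z m₀ m₁ m₂ m₃ m₄ : ℂ} (hxy : x ≠ y) (hxz : x ≠ z) (hyz : y ≠ z)
    (h₃ : m₃ = (x + y + z) * m₂ - (x * y + x * z + y * z) * m₁ + x * y * z * m₀)
    (h₄ : m₄ = (x + y + z) * m₃ - (x * y + x * z + y * z) * m₂ + x * y * z * m₁) :
    ∃ p q r : ℂ, p + q + r = m₀ ∧ p * x + q * y + r * z = m₁ ∧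
      p * x ^ 2 + q * y ^ 2 + r * z ^ 2 = m₂ ∧ p * x ^ 3 + q * y ^ 3 + r * z ^ 3 = m₃ ∧
      p * x ^ 4 + q * y ^ 4 + r * z ^ 4 = m₄ := by
  have hxy' := sub_ne_zero.mpr hxy
  have hxz' := sub_ne_zero.mpr hxz
  have hyz' := sub_ne_zero.mpr hyz
  obtain ⟨p, q, r, e₀, e₁, e₂⟩ : ∃ p q r : ℂ, p + q + r = m₀ ∧ p * x + q * y + r * z = m₁ ∧
      p * x ^ 2 + q * y ^ 2 + r * z ^ 2 = m₂ := by
    refine ⟨(m₂ - (y + z) * m₁ + y * z * m₀) / ((x - y) * (x - z)),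
      -(m₂ - (x + z) * m₁ + x * z * m₀) / ((x - y) * (y - z)),
      (m₂ - (x + y) * m₁ + x * y * m₀) / ((x - z) * (y - z)), ?_, ?_, ?_⟩ <;>
    · field_simp
      ring
  have e₃ : p * x ^ 3 + q * y ^ 3 + r * z ^ 3 = m₃ := by
    rw [h₃, ← e₀, ← e₁, ← e₂]
    ring
  refine ⟨p, q, r, e₀, e₁, e₂, e₃, ?_⟩
  rw [h₄, ← e₃, ← e₁, ← e₂]
  ring

/-- A complex monic cubic with nonzero discriminant has three distinct roots. -/
lemma exists_roots_of_discr_ne_zero {b c d : ℂ} (h : (⟨1, b, c, d⟩ : Cubic ℂ).discr ≠ 0) :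
    ∃ x y z : ℂ, x ≠ y ∧ x ≠ z ∧ y ≠ z ∧ b = -(x + y + z) ∧ c = x * y + x * z + y * z ∧
      d = -(x * y * z) := by
  set P : Cubic ℂ := ⟨1, b, c, d⟩ with hP
  have ha : P.a ≠ 0 := one_ne_zero
  obtain ⟨x, y, z, h3⟩ := (Cubic.splits_iff_roots_eq_three (φ := RingHom.id ℂ) ha).mp
    (IsAlgClosed.splits _)
  obtain ⟨hxy, hxz, hyz⟩ := (Cubic.discr_ne_zero_iff_roots_ne ha h3).mp h
  have hb := Cubic.b_eq_three_roots ha h3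
  have hc := Cubic.c_eq_three_roots ha h3
  have hd := Cubic.d_eq_three_roots ha h3
  simp [hP] at hb hc hd
  exact ⟨x, y, z, hxy, hxz, hyz, by rw [hb]; ring, hc, hd⟩

/-- The point with parameter `t` on the curve of elementary tensors spanned by four lines. -/
def curve4 (f g : Fin 4 → Fin 2 → ℂ) (t : ℂ) : Fin 2 → Fin 2 → Fin 2 → Fin 2 → ℂ :=
  elem4 (f 0 + t • g 0) (f 1 + t • g 1) (f 2 + t • g 2) (f 3 + t • g 3)

lemma elementary4_smul_curve4 (f g : Fin 4 → Fin 2 → ℂ) (p t : ℂ) :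
    Elementary4 (p • curve4 f g t) := by
  refine ⟨p • (f 0 + t • g 0), f 1 + t • g 1, f 2 + t • g 2, f 3 + t • g 3, ?_⟩
  ext i j k l
  simp [curve4, elem4]
  ring

lemma eq_of_smul_curve4_eq {f g : Fin 4 → Fin 2 → ℂ} {p q s t : ℂ}
    (hfg : f 0 0 * g 0 1 - f 0 1 * g 0 0 ≠ 0) (hne : p • curve4 f g s ≠ 0)
    (h : p • curve4 f g s = q • curve4 f g t) : s = t := by
  obtain ⟨i, hi⟩ := Function.ne_iff.mp hne
  obtain ⟨j, hj⟩ := Function.ne_iff.mp hi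
  obtain ⟨k, hk⟩ := Function.ne_iff.mp hj
  obtain ⟨l, hl⟩ := Function.ne_iff.mp hk
  have e0 := congrFun (congrFun (congrFun (congrFun h 0) j) k) l
  have e1 := congrFun (congrFun (congrFun (congrFun h 1) j) k) l
  simp [curve4, elem4] at e0 e1 hl
  set Y := p * ((f 1 j + s * g 1 j) * (f 2 k + s * g 2 k) * (f 3 l + s * g 3 l)) with hY
  have hY0 : Y ≠ 0 := by
    simp [hY, hl]
  have : Y * (f 0 0 * g 0 1 - f 0 1 * g 0 0) * (t - s) = 0 := by
    rw [hY]
    linear_combination (f 0 1 + t * g 0 1) * e0 - (f 0 0 + t * g 0 0) * e1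
  simp [hY0, hfg, sub_eq_zero] at this
  exact this.symm

/-- The general case: three points of the curve, with parameters `0, 1, -1`. -/
lemma infinite_summands_curve4 {f g : Fin 4 → Fin 2 → ℂ} {β γ : ℂ} (hβ : β ≠ 0) (hγ : γ ≠ 0)
    (hfg : f 0 0 * g 0 1 - f 0 1 * g 0 0 ≠ 0)
    (hrk : ∀ Y Z, Elementary4 Y → Elementary4 Z →
      curve4 f g 0 + β • curve4 f g 1 + γ • curve4 f g (-1) ≠ Y + Z) :
    (summands (curve4 f g 0 + β • curve4 f g 1 + γ • curve4 f g (-1))).Infinite := by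
  set T := curve4 f g 0 + β • curve4 f g 1 + γ • curve4 f g (-1) with hT
  obtain ⟨g₁, hg₁⟩ : ∃ g₁ : ℂ, g₁ = (1 / β - 1 / γ) / 2 := ⟨_, rfl⟩
  obtain ⟨g₂, hg₂⟩ : ∃ g₂ : ℂ, g₂ = (1 / β + 1 / γ) / 2 + 2 := ⟨_, rfl⟩
  set Q : Polynomial ℂ := (⟨1, Polynomial.X * Polynomial.C g₂, Polynomial.X * Polynomial.C g₁ - 1,
    -2 * Polynomial.X⟩ : Cubic (Polynomial ℂ)).discr with hQ
  have hev : ∀ s, Q.eval s = (⟨1, s * g₂, s * g₁ - 1, -2 * s⟩ : Cubic ℂ).discr := by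
    intro s
    simp [hQ, Cubic.discr]
    ring
  have h0 : Q.eval 0 ≠ 0 := by
    rw [hev]
    norm_num [Cubic.discr]
  have key : ∀ s : ℂ, Q.eval s ≠ 0 → ∃ p x : ℂ,
      x ^ 3 - x + s * (g₂ * x ^ 2 + g₁ * x - 2) = 0 ∧ p • curve4 f g x ≠ 0 ∧
      p • curve4 f g x ∈ summands T := by
    intro s hs
    rw [hev] at hs
    obtain ⟨x, y, z, hxy, hxz, hyz, hb, hc, hd⟩ := exists_roots_of_discr_ne_zero hs
    obtain ⟨p, q, r, e₀, e₁, e₂, e₃, e₄⟩ := exists_weights (m₀ := 1 + β + γ) (m₁ := β - γ)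
      (m₂ := β + γ) (m₃ := β - γ) (m₄ := β + γ) hxy hxz hyz
      (by
        have : s * (g₂ * (β + γ) + g₁ * (β - γ) - 2 * (1 + β + γ)) = 0 := by
          rw [hg₁, hg₂]
          field_simp
          ring
        linear_combination this - (β + γ) * hb - (β - γ) * hc - (1 + β + γ) * hd)
      (by
        have : s * (g₂ * (β - γ) + g₁ * (β + γ) - 2 * (β - γ)) = 0 := by
          rw [hg₁, hg₂]
          field_simp
          ring
        linear_combination this - (β - γ) * hb - (β + γ) * hc - (β - γ) * hd)
    have hsum : T = p • curve4 f g x + q • curve4 f g y + r • curve4 f g z := by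
      ext i j k l
      simp [hT, curve4, elem4]
      linear_combination
        -(f 0 i * f 1 j * f 2 k * f 3 l) * e₀
        - (g 0 i * f 1 j * f 2 k * f 3 l + f 0 i * g 1 j * f 2 k * f 3 l
          + f 0 i * f 1 j * g 2 k * f 3 l + f 0 i * f 1 j * f 2 k * g 3 l) * e₁
        - (g 0 i * g 1 j * f 2 k * f 3 l + g 0 i * f 1 j * g 2 k * f 3 l
          + g 0 i * f 1 j * f 2 k * g 3 l + f 0 i * g 1 j * g 2 k * f 3 l
          + f 0 i * g 1 j * f 2 k * g 3 l + f 0 i * f 1 j * g 2 k * g 3 l) * e₂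
        - (f 0 i * g 1 j * g 2 k * g 3 l + g 0 i * f 1 j * g 2 k * g 3 l
          + g 0 i * g 1 j * f 2 k * g 3 l + g 0 i * g 1 j * g 2 k * f 3 l) * e₃
        - (g 0 i * g 1 j * g 2 k * g 3 l) * e₄
    refine ⟨p, x, ?_, ?_, elementary4_smul_curve4 _ _ _ _, q • curve4 f g y, r • curve4 f g z,
      elementary4_smul_curve4 _ _ _ _, elementary4_smul_curve4 _ _ _ _, hsum⟩
    · linear_combination x ^ 2 * hb + x * hc + hd
    · intro hp
      rw [hp, zero_add] at hsum
      exact hrk _ _ (elementary4_smul_curve4 _ _ _ _) (elementary4_smul_curve4 _ _ _ _) hsum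
  choose! p x hx hne hmem using key
  refine infinite_of_injOn (infinite_eval_ne_zero h0) (fun s => p s • curve4 f g (x s)) ?_
    (fun s hs => hmem s hs)
  intro s hs s' hs' h
  have hxx : x s = x s' := eq_of_smul_curve4_eq hfg (hne s hs) h
  have e := hx s hs
  have e' := hx s' hs'
  rw [← hxx] at e'
  generalize x s = y at e e'
  have hprod : (s - s') * (g₂ * y ^ 2 + g₁ * y - 2) = 0 := by linear_combination e - e'
  rcases mul_eq_zero.mp hprod with hs0 | hG
  · exact sub_eq_zero.mp hs0
  · exfalso
    have hy : y * ((y - 1) * (y + 1)) = 0 := by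
      linear_combination e - s * hG
    rcases mul_eq_zero.mp hy with hy | hy
    · rw [hy] at hG
      norm_num at hG
    rcases mul_eq_zero.mp hy with hy | hy
    · have : 1 / β = 0 := by
        rw [hg₁, hg₂, sub_eq_zero.mp hy] at hG
        linear_combination hG
      simp [hβ] at this
    · have : 1 / γ = 0 := by
        rw [hg₁, hg₂, eq_neg_of_add_eq_zero_left hy] at hG
        linear_combination hG
      simp [hγ] at this

lemma infinite_summands_of_pairwise {a b c d : Fin 3 → Fin 2 → ℂ}
    (ha : ∀ i j, i ≠ j → a i 0 * a j 1 ≠ a i 1 * a j 0)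
    (hb : ∀ i j, i ≠ j → b i 0 * b j 1 ≠ b i 1 * b j 0)
    (hc : ∀ i j, i ≠ j → c i 0 * c j 1 ≠ c i 1 * c j 0)
    (hd : ∀ i j, i ≠ j → d i 0 * d j 1 ≠ d i 1 * d j 0)
    (hrk : ∀ Y Z, Elementary4 Y → Elementary4 Z →
      ∑ s, elem4 (a s) (b s) (c s) (d s) ≠ Y + Z) :
    (summands (∑ s, elem4 (a s) (b s) (c s) (d s))).Infinite := by
  obtain ⟨f₀, g₀, q₀, r₀, hfg, hq₀, hr₀, ha0, ha1, ha2⟩ := exists_nodes ha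
  obtain ⟨f₁, g₁, q₁, r₁, -, hq₁, hr₁, hb0, hb1, hb2⟩ := exists_nodes hb
  obtain ⟨f₂, g₂, q₂, r₂, -, hq₂, hr₂, hc0, hc1, hc2⟩ := exists_nodes hc
  obtain ⟨f₃, g₃, q₃, r₃, -, hq₃, hr₃, hd0, hd1, hd2⟩ := exists_nodes hd
  have hsum : ∑ s, elem4 (a s) (b s) (c s) (d s) =
      curve4 ![f₀, f₁, f₂, f₃] ![g₀, g₁, g₂, g₃] 0
      + (q₀ * q₁ * q₂ * q₃) • curve4 ![f₀, f₁, f₂, f₃] ![g₀, g₁, g₂, g₃] 1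
      + (r₀ * r₁ * r₂ * r₃) • curve4 ![f₀, f₁, f₂, f₃] ![g₀, g₁, g₂, g₃] (-1) := by
    rw [Fin.sum_univ_three, ha0, ha1, ha2, hb0, hb1, hb2, hc0, hc1, hc2, hd0, hd1, hd2]
    ext i j k l
    simp [curve4, elem4]
    ring
  rw [hsum] at hrk ⊢
  refine infinite_summands_curve4 ?_ ?_ hfg hrk
  · simp [hq₀, hq₁, hq₂, hq₃]
  · simp [hr₀, hr₁, hr₂, hr₃]

lemma infinite_summands_of_rank4_eq_three {T : Fin 2 → Fin 2 → Fin 2 → Fin 2 → ℂ}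
    (hrk : rank4 T = 3) : (summands T).Infinite := by
  have hdec : ∃ t : Fin 3 → (Fin 2 → Fin 2 → Fin 2 → Fin 2 → ℂ),
      (∀ s, Elementary4 (t s)) ∧ T = ∑ s, t s := by
    have hne := Nat.nonempty_of_sInf_eq_succ (k := 2) hrk
    have := Nat.sInf_mem hne
    rw [show sInf _ = 3 from hrk] at this
    exact this
  have hmin : ∀ Y Z, Elementary4 Y → Elementary4 Z → T ≠ Y + Z := by
    intro Y Z hY hZ h
    have : rank4 T ≤ 2 := by
      refine Nat.sInf_le ⟨![Y, Z], ?_, ?_⟩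
      · intro s
        fin_cases s <;> assumption
      · rw [Fin.sum_univ_two]
        exact h
    omega
  obtain ⟨t, ht, hT⟩ := hdec
  have hne : ∀ s, t s ≠ 0 := by
    intro s h0
    rw [Fin.sum_univ_three] at hT
    fin_cases s
    · exact hmin _ _ (ht 1) (ht 2) (by rw [hT, show t 0 = 0 from h0, zero_add])
    · exact hmin _ _ (ht 0) (ht 2) (by rw [hT, show t 1 = 0 from h0, add_zero])
    · exact hmin _ _ (ht 0) (ht 1) (by rw [hT, show t 2 = 0 from h0, add_zero])
  choose a b c d habcd using ht
  have hel : ∀ s, t s = elem4 (a s) (b s) (c s) (d s) := habcd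
  simp only [hel] at hT hne
  have ha : ∀ s, a s ≠ 0 := fun s h => hne s (by ext; simp [elem4, h])
  have hb : ∀ s, b s ≠ 0 := fun s h => hne s (by ext; simp [elem4, h])
  have hc : ∀ s, c s ≠ 0 := fun s h => hne s (by ext; simp [elem4, h])
  have hd : ∀ s, d s ≠ 0 := fun s h => hne s (by ext; simp [elem4, h])
  subst hT
  by_cases pa : ∃ i j, i ≠ j ∧ a i 0 * a j 1 = a i 1 * a j 0
  · obtain ⟨i, j, hij, h⟩ := pa
    exact infinite_summands_of_parallel ha hb hc hd hij h
  by_cases pb : ∃ i j, i ≠ j ∧ b i 0 * b j 1 = b i 1 * b j 0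
  · obtain ⟨i, j, hij, h⟩ := pb
    apply infinite_summands_swap01
    convert infinite_summands_of_parallel hb ha hc hd hij h using 2
    ext i j k l
    simp only [Finset.sum_apply, elem4]
    exact Finset.sum_congr rfl fun s _ => by ring
  by_cases pc : ∃ i j, i ≠ j ∧ c i 0 * c j 1 = c i 1 * c j 0
  · obtain ⟨i, j, hij, h⟩ := pc
    apply infinite_summands_swap02
    convert infinite_summands_of_parallel hc hb ha hd hij h using 2
    ext i j k l
    simp only [Finset.sum_apply, elem4]
    exact Finset.sum_congr rfl fun s _ => by ring
  by_cases pd : ∃ i j, i ≠ j ∧ d i 0 * d j 1 = d i 1 * d j 0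
  · obtain ⟨i, j, hij, h⟩ := pd
    apply infinite_summands_swap03
    convert infinite_summands_of_parallel hd hb hc ha hij h using 2
    ext i j k l
    simp only [Finset.sum_apply, elem4]
    exact Finset.sum_congr rfl fun s _ => by ring
  push Not at pa pb pc pd
  exact infinite_summands_of_pairwise pa pb pc pd hmin

/-- Every concise rank-3 tensor in `ℂ²⊗ℂ²⊗ℂ²⊗ℂ²` is not identifiable; in fact it
admits infinitely many pairwise inequivalent decompositions as sums of 3
elementary tensors. -/
theorem stmt6 (T : Fin 2 → Fin 2 → Fin 2 → Fin 2 → ℂ)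
    (hconc : Concise4 T) (hrk : rank4 T = 3) :
    ¬ IdentifiableWith4 T 3 ∧
    ∃ D : ℕ → (Fin 3 → (Fin 2 → Fin 2 → Fin 2 → Fin 2 → ℂ)),
      (∀ m, (∀ s, Elementary4 (D m s)) ∧ T = ∑ s, D m s) ∧
      ∀ m m', m ≠ m' →
        ¬ ∃ σ : Equiv.Perm (Fin 3), ∀ s, D m' s = D m (σ s) := by
  obtain ⟨D, hD, hne⟩ := exists_inequivalent_of_infinite_summands
    (infinite_summands_of_rank4_eq_three hrk)
  refine ⟨fun hid => ?_, D, hD, hne⟩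
  exact hne 0 1 zero_ne_one (hid (D 0) (D 1) (hD 0).1 (hD 1).1 (hD 0).2 (hD 1).2)
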